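/- arXiv:2009.06708 — 2 statements merged into one kernel-verified Lean document; each statement's English description precedes it below -/
import Mathlib

section
/- Let G be a group containing a finite normal subgroup N such that the quotient group G/N is infinite cyclic. Let A be a G-module (an abelian group with G-action by automorphisms) on which multiplication by the order |N| of N is bijective. Then H²(G, A) = 0. -/
open groupCohomology

namespace groupCohomology

universe u

variable {k G : Type u} [CommRing k] [Group G] {A : Rep.{u} k G} {N : Subgroup G}

/-- Subtracting the coboundary of a 1-cochain from a 2-cocycle gives a cohomologous 2-cocycle. -/
theorem exists_cocycles₂_eq_sub (f : cocycles₂ A) (c : G → A) :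
    ∃ f' : cocycles₂ A, ⇑f - ⇑f' ∈ coboundaries₂ A ∧
      ∀ g h : G, f' (g, h) = f (g, h) - (A.ρ g (c h) - c (g * h) + c g) :=
  ⟨f - ⟨(d₁₂ A).hom c, d₁₂_apply_mem_cocycles₂ c⟩,
    ⟨c, (sub_sub_cancel (f : G × G → A) (d₁₂ A c)).symm⟩, fun _ _ => rfl⟩

/-- If `|N|` is invertible on `A`, then every 2-cocycle is cohomologous to one that is right
`N`-invariant in the second variable and vanishes when the second variable lies in `N`. -/
theorem exists_cocycles₂_right_invariant [Finite N]
    (hA : Function.Bijective (fun a : A => Nat.card N • a)) (f : cocycles₂ A) :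
    ∃ f' : cocycles₂ A, ⇑f - ⇑f' ∈ coboundaries₂ A ∧
      (∀ g h : G, ∀ n ∈ N, f' (g, h * n) = f' (g, h)) ∧ ∀ g : G, ∀ n ∈ N, f' (g, n) = 0 := by
  have := Fintype.ofFinite N
  choose c hc using fun g : G => hA.2 (∑ n : N, f (g, (n : G)))
  obtain ⟨f', hf', hval⟩ := exists_cocycles₂_eq_sub f c
  have key (g h : G) :
      Nat.card N • f' (g, h) = ∑ n : N, f (g, h * n) - ∑ n : N, f (g, (n : G)) := by
    have hsum := Finset.sum_congr (rfl : (Finset.univ : Finset N) = _)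
      fun n _ => (mem_cocycles₂_iff (f : G × G → A)).1 f.2 g h n
    simp only [Finset.sum_add_distrib, Finset.sum_const, Finset.card_univ,
      ← Nat.card_eq_fintype_card, ← map_sum, ← hc, map_nsmul] at hsum
    rw [hval, ← hc]
    simp only [smul_sub, smul_add]
    rw [← sub_eq_zero] at hsum ⊢
    rw [← hsum]
    abel
  have hinv (g h n : G) (hn : n ∈ N) : f' (g, h * n) = f' (g, h) := by
    apply hA.1
    simp only [key, mul_assoc]
    congr 1
    exact Equiv.sum_comp (Equiv.mulLeft (⟨n, hn⟩ : N)) fun m : N => f (g, h * m)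
  refine ⟨f', hf', hinv, fun g n hn => ?_⟩
  rw [← one_mul n, hinv g 1 n hn]
  apply hA.1
  simp only [key, one_mul, sub_self, smul_zero]

/-- If `|N|` is invertible on `A`, then every 2-cocycle is cohomologous to one that is right
`N`-invariant in both variables and vanishes when the second variable is `1`, i.e. one
inflated from `G ⧸ N`. -/
theorem exists_cocycles₂_inflated [Finite N] [N.Normal]
    (hA : Function.Bijective (fun a : A => Nat.card N • a)) (f : cocycles₂ A) :
    ∃ f' : cocycles₂ A, ⇑f - ⇑f' ∈ coboundaries₂ A ∧
      (∀ g h : G, ∀ n ∈ N, f' (g, h * n) = f' (g, h)) ∧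
      (∀ g h : G, ∀ n ∈ N, f' (g * n, h) = f' (g, h)) ∧ ∀ g : G, f' (g, 1) = 0 := by
  have := Fintype.ofFinite N
  obtain ⟨f₁, hf₁, hinv, hzero⟩ := exists_cocycles₂_right_invariant hA f
  have hinv' (g h n : G) (hn : n ∈ N) : f₁ (g, n * h) = f₁ (g, h) := by
    have := hinv g h (h⁻¹ * n * h) (by simpa using ‹N.Normal›.conj_mem n hn h⁻¹)
    rwa [mul_assoc, mul_inv_cancel_left] at this
  have hleft (g h n : G) (hn : n ∈ N) : f₁ (g * n, h) = f₁ (g, h) + A.ρ g (f₁ (n, h)) := by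
    have := (mem_cocycles₂_iff (f₁ : G × G → A)).1 f₁.2 g n h
    rw [hzero g n hn, hinv' g h n hn] at this
    rw [← add_zero (f₁ (g * n, h)), this, add_comm]
  choose b hb using fun h : G => hA.2 (∑ n : N, f₁ ((n : G), h))
  have hb_inv (h n : G) (hn : n ∈ N) : b (h * n) = b h := by
    apply hA.1
    simp only [hb, hinv _ h n hn]
  have hb_inv' (h n : G) (hn : n ∈ N) : b (n * h) = b h := by
    apply hA.1
    simp only [hb, hinv' _ h n hn]
  have hb_one : b 1 = 0 := by
    apply hA.1
    simp only [hb, hzero _ 1 N.one_mem, Finset.sum_const_zero, smul_zero]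
  have hb_split (h n : G) (hn : n ∈ N) : f₁ (n, h) = b h - A.ρ n (b h) := by
    apply hA.1
    have hsum := Equiv.sum_comp (Equiv.mulLeft (⟨n, hn⟩ : N)) fun m : N => f₁ ((m : G), h)
    simp only [Equiv.coe_mulLeft, Subgroup.coe_mul, fun m : N => hleft n h m m.2,
      Finset.sum_add_distrib, Finset.sum_const, Finset.card_univ,
      ← Nat.card_eq_fintype_card, ← map_sum, ← hb, map_nsmul] at hsum
    simp only [smul_sub]
    exact eq_sub_of_add_eq hsum
  obtain ⟨f₂, hf₂, hval⟩ := exists_cocycles₂_eq_sub f₁ (-b)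
  refine ⟨f₂, ?_, fun g h n hn => ?_, fun g h n hn => ?_, fun g => ?_⟩
  · simpa using add_mem hf₁ hf₂
  · simp only [hval, Pi.neg_apply, ← mul_assoc, hinv g h n hn, hb_inv _ n hn]
  · simp only [hval, Pi.neg_apply, hleft g h n hn, hb_split h n hn, hb_inv _ n hn, mul_assoc g n h,
      map_mul, Module.End.mul_apply, map_sub, map_neg]
    have : b (g * (n * h)) = b (g * h) := by
      have := hb_inv' (g * h) (g * n * g⁻¹) (‹N.Normal›.conj_mem n hn g)
      rwa [← mul_assoc, inv_mul_cancel_right, mul_assoc] at this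
    rw [this]
    abel
  · simp [hval, hb_one, hzero g 1 N.one_mem]

/-- Every sequence indexed by `ℤ` is the sequence of differences `c i - c (i + 1)` of another one. -/
theorem exists_int_sub_eq {M : Type*} [AddCommGroup M] (a : ℤ → M) :
    ∃ c : ℤ → M, ∀ i, c (i + 1) = c i - a i := by
  let c : ℤ → M
    | .ofNat n => -∑ i ∈ Finset.range n, a i
    | .negSucc n => ∑ i ∈ Finset.range (n + 1), a (Int.negSucc i)
  refine ⟨c, fun i => ?_⟩
  match i with
  | .ofNat n =>
    change -∑ i ∈ Finset.range (n + 1), a i = -∑ i ∈ Finset.range n, a i - a n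
    rw [Finset.sum_range_succ, neg_add, sub_eq_add_neg]
  | .negSucc 0 =>
    change -∑ i ∈ Finset.range 0, a i = ∑ i ∈ Finset.range 1, a (Int.negSucc i) - a (Int.negSucc 0)
    simp
  | .negSucc (n + 1) =>
    change ∑ i ∈ Finset.range (n + 1), a (Int.negSucc i) =
      ∑ i ∈ Finset.range (n + 1 + 1), a (Int.negSucc i) - a (Int.negSucc (n + 1))
    rw [Finset.sum_range_succ _ (n + 1), add_sub_cancel_right]

/-- If `G ⧸ N` is infinite cyclic, then every 2-cocycle inflated from `G ⧸ N` is a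
coboundary. -/
theorem mem_coboundaries₂_of_inflated [N.Normal] (e : (G ⧸ N) ≃* Multiplicative ℤ)
    (f : cocycles₂ A) (hright : ∀ g h : G, ∀ n ∈ N, f (g, h * n) = f (g, h))
    (hleft : ∀ g h : G, ∀ n ∈ N, f (g * n, h) = f (g, h)) (hone : ∀ g : G, f (g, 1) = 0) :
    ⇑f ∈ coboundaries₂ A := by
  let p : G → ℤ := fun g => (e g).toAdd
  have hp_mul (g h : G) : p (g * h) = p g + p h := by simp [p]
  have hp_mem (n : G) (hn : n ∈ N) : p n = 0 := by
    simp [p, (QuotientGroup.eq_one_iff n).2 hn]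
  obtain ⟨t, ht⟩ := QuotientGroup.mk_surjective (e.symm (Multiplicative.ofAdd 1))
  have hpt : p t = 1 := by simp [p, ht]
  have hdecomp (g : G) : ∃ n ∈ N, g = t ^ p g * n := by
    refine ⟨(t ^ p g)⁻¹ * g, QuotientGroup.eq.1 (e.injective ?_), by group⟩
    apply Multiplicative.toAdd.injective
    simp [p, ht]
  obtain ⟨c₀, hc₀⟩ := exists_int_sub_eq fun i => f (t ^ i, t)
  let c : G → A := fun g => c₀ (p g) - c₀ 0
  have hc_inv (g n : G) (hn : n ∈ N) : c (g * n) = c g := by simp [c, hp_mul, hp_mem n hn]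
  have hc_one : c 1 = 0 := by simp [c, hp_mem 1 N.one_mem]
  have hc_succ (g : G) : c (g * t) = c g - f (g, t) := by
    obtain ⟨n, hn, hg⟩ := hdecomp g
    have : f (g, t) = f (t ^ p g, t) := by
      conv_lhs => rw [hg, hleft _ _ n hn]
    simp only [c, hp_mul, hpt, hc₀, this]
    abel
  obtain ⟨f', hf', hval⟩ := exists_cocycles₂_eq_sub f c
  have hstep (g h : G) : f' (g, h * t) = f' (g, h) := by
    have := (mem_cocycles₂_iff (f : G × G → A)).1 f.2 g h t
    simp only [hval, hc_succ, ← mul_assoc, map_sub]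
    rw [← sub_eq_zero] at this ⊢
    rw [← neg_eq_zero, ← this]
    abel
  have hpow (g : G) (i : ℤ) : f' (g, t ^ i) = 0 := by
    induction i with
    | zero => simp [hval, hone, hc_one]
    | succ i hi => rw [zpow_add_one, hstep, hi]
    | pred i hi => rw [← hstep, ← zpow_add_one, sub_add_cancel, hi]
  have hf'_zero : ⇑f' = 0 := by
    ext ⟨g, h⟩
    obtain ⟨n, hn, hh⟩ := hdecomp h
    have : f' (g, t ^ p h * n) = f' (g, t ^ p h) := by
      simp only [hval, hright g _ n hn, ← mul_assoc, hc_inv _ n hn]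
    rw [hh, this, hpow]
    rfl
  rwa [hf'_zero, sub_zero] at hf'

end groupCohomology

/-- Let `G` be a group with a finite normal subgroup `N` such that `G ⧸ N` is
infinite cyclic, and let `A` be a `G`-module on which multiplication by `|N|` is
bijective. Then `H²(G, A) = 0`. -/
theorem groupCohomology_two_vanishing_of_finite_by_infinite_cyclic
    (G : Type) [Group G] (N : Subgroup G) [N.Normal] [Finite N]
    (hcyc : Nonempty ((G ⧸ N) ≃* Multiplicative ℤ))
    (A : Rep ℤ G)
    (hA : Function.Bijective (fun a : A => (Nat.card N : ℤ) • a)) :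
    Subsingleton (groupCohomology A 2) := by
  obtain ⟨e⟩ := hcyc
  refine subsingleton_of_forall_eq 0 fun x => H2_induction_on x fun f => ?_
  obtain ⟨f', hf', hright, hleft, hone⟩ := exists_cocycles₂_inflated (by simpa using hA) f
  rw [H2π_eq_zero_iff]
  simpa using add_mem hf' (mem_coboundaries₂_of_inflated e f' hright hleft hone)
end

section
/- Let G be a finite group and A a G-module (an abelian group with G-action by automorphisms) that is finitely generated as an abelian group. Then there exist finitely many subgroups I₁, …, I_r of G and a surjective morphism of G-modules f : ⊕_{j=1}^{r} ℤ[G/I_j] → A from a finite direct sum of permutation modules ℤ[G/I_j], such that for every subgroup I of G the induced map on I-invariants (⊕_{j} ℤ[G/I_j])^I → A^I is surjective. -/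
namespace PermutationModule

variable {G A : Type*} [Group G] [AddCommGroup A] [DistribMulAction G A]

/-- The equivariant map `G ⧸ I → A`, `g I ↦ g • y`, attached to an `I`-invariant element `y`. -/
def orbitMap (I : Subgroup G) (y : A) (hy : ∀ h ∈ I, h • y = y) (q : G ⧸ I) : A :=
  Quotient.liftOn' q (fun g => g • y) fun a b hab => by
    have h := hy _ (QuotientGroup.leftRel_apply.mp hab)
    rw [mul_smul, inv_smul_eq_iff] at h
    exact h.symm

theorem orbitMap_smul (I : Subgroup G) (y : A) (hy : ∀ h ∈ I, h • y = y) (g : G) (q : G ⧸ I) :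
    orbitMap I y hy (g • q) = g • orbitMap I y hy q := by
  induction q using QuotientGroup.induction_on with
  | H a => exact mul_smul g a y

theorem orbitMap_one (I : Subgroup G) (y : A) (hy : ∀ h ∈ I, h • y = y) :
    orbitMap I y hy ((1 : G) : G ⧸ I) = y :=
  one_smul G y

variable {ι : Type*} (I : ι → Subgroup G) (y : ι → A) (hy : ∀ i, ∀ h ∈ I i, h • y i = y i)

/-- The map `⊕ᵢ ℤ[G ⧸ I i] → A` sending the coset `g (I i)` to `g • y i`. -/
noncomputable def sumMap : ((Σ i, G ⧸ I i) →₀ ℤ) →+ A :=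
  Finsupp.liftAddHom fun s => zmultiplesHom A (orbitMap (I s.1) (y s.1) (hy s.1) s.2)

theorem sumMap_single (s : Σ i, G ⧸ I i) (n : ℤ) :
    sumMap I y hy (Finsupp.single s n) = n • orbitMap (I s.1) (y s.1) (hy s.1) s.2 := by
  simp [sumMap]

theorem sumMap_mapDomain (g : G) (x : (Σ i, G ⧸ I i) →₀ ℤ) :
    sumMap I y hy (Finsupp.mapDomain (fun s : Σ i, G ⧸ I i => ⟨s.1, g • s.2⟩) x) =
      g • sumMap I y hy x := by
  induction x using Finsupp.induction_linear with
  | zero => simp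
  | add u v hu hv => rw [Finsupp.mapDomain_add, map_add, map_add, hu, hv, smul_add]
  | single s n =>
    rw [Finsupp.mapDomain_single, sumMap_single, sumMap_single, orbitMap_smul,
      ← DistribSMul.toAddMonoidHom_apply A g (n • _), map_zsmul, DistribSMul.toAddMonoidHom_apply]

/-- If the `y i` with `I i = J` generate a subgroup, each of its elements lifts to a `J`-invariant
element of `⊕ᵢ ℤ[G ⧸ I i]`. -/
theorem exists_invariant_sumMap_eq (J : Subgroup G) {a : A}
    (ha : a ∈ AddSubgroup.closure {b | ∃ i, I i = J ∧ y i = b}) :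
    ∃ x : (Σ i, G ⧸ I i) →₀ ℤ,
      (∀ h ∈ J, Finsupp.mapDomain (fun s : Σ i, G ⧸ I i => ⟨s.1, h • s.2⟩) x = x) ∧
        sumMap I y hy x = a := by
  induction ha using AddSubgroup.closure_induction with
  | mem b hb =>
    obtain ⟨i, rfl, rfl⟩ := hb
    refine ⟨Finsupp.single ⟨i, ((1 : G) : G ⧸ I i)⟩ 1, fun h hh => ?_, ?_⟩
    · have : h • ((1 : G) : G ⧸ I i) = ((1 : G) : G ⧸ I i) :=
        QuotientGroup.eq.mpr (by simpa using hh)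
      rw [Finsupp.mapDomain_single, this]
    · rw [sumMap_single, orbitMap_one, one_smul]
  | zero => exact ⟨0, fun h _ => Finsupp.mapDomain_zero, map_zero _⟩
  | add b c _ _ hb hc =>
    obtain ⟨u, hu, rfl⟩ := hb
    obtain ⟨v, hv, rfl⟩ := hc
    exact ⟨u + v, fun h hh => by rw [Finsupp.mapDomain_add, hu h hh, hv h hh], map_add _ _ _⟩
  | neg b _ hb =>
    obtain ⟨u, hu, rfl⟩ := hb
    refine ⟨-u, fun h hh => ?_, map_neg _ _⟩
    have := map_neg (Finsupp.mapDomain.addMonoidHom (M := ℤ)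
      (fun s : Σ i, G ⧸ I i => (⟨s.1, h • s.2⟩ : Σ i, G ⧸ I i))) u
    simp only [Finsupp.mapDomain.addMonoidHom_apply, hu h hh] at this
    exact this

variable (G A) in
/-- The subgroups of invariants of a finitely generated module are finitely generated. -/
theorem exists_finset_closure_eq_invariants [AddGroup.FG A] (J : Subgroup G) :
    ∃ S : Finset A, (∀ b ∈ S, ∀ h ∈ J, h • b = b) ∧
      ∀ a : A, (∀ h ∈ J, h • a = a) → a ∈ AddSubgroup.closure (S : Set A) := by
  have : Module.Finite ℤ A := Module.Finite.iff_addGroup_fg.mpr inferInstance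
  let B : AddSubgroup A := FixedPoints.addSubgroup J A
  obtain ⟨S, hS⟩ := (Submodule.fg_iff_addSubgroup_fg _).mp
    (IsNoetherian.noetherian (AddSubgroup.toIntSubmodule B))
  have hB : ∀ a, a ∈ AddSubgroup.closure (S : Set A) ↔ ∀ h ∈ J, h • a = a := fun a => by
    rw [hS]
    exact ⟨fun ha h hh => ha ⟨h, hh⟩, fun ha h => ha h h.2⟩
  exact ⟨S, fun b hb => (hB b).mp (AddSubgroup.subset_closure hb), fun a => (hB a).mpr⟩

end PermutationModule

/-- Let `G` be a finite group and `A` a `G`-module which is finitely generated as an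
abelian group. Then there exist finitely many subgroups `I₁, …, I_r` of `G` and a
surjective `G`-equivariant morphism `f : ⊕ⱼ ℤ[G/Iⱼ] → A` from a finite direct sum of
permutation modules (realized as finitely supported `ℤ`-valued functions on
`Σ j, G ⧸ Iⱼ`, with `G` acting by translating the cosets) such that for every
subgroup `I` of `G` the induced map on `I`-invariants is surjective. -/
theorem exists_permutation_module_surjection_invariants_surjective
    (G : Type) [Group G] [Finite G]
    (A : Type) [AddCommGroup A] [DistribMulAction G A] [AddGroup.FG A] :
    ∃ (r : ℕ) (I : Fin r → Subgroup G)
      (f : ((Σ j : Fin r, G ⧸ I j) →₀ ℤ) →+ A),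
      Function.Surjective f ∧
      (∀ (g : G) (x : (Σ j : Fin r, G ⧸ I j) →₀ ℤ),
        f (Finsupp.mapDomain
            (fun s : Σ j : Fin r, G ⧸ I j => ⟨s.1, g • s.2⟩) x) = g • f x) ∧
      (∀ J : Subgroup G, ∀ a : A, (∀ h ∈ J, h • a = a) →
        ∃ x : (Σ j : Fin r, G ⧸ I j) →₀ ℤ,
          (∀ h ∈ J, Finsupp.mapDomain
              (fun s : Σ j : Fin r, G ⧸ I j => ⟨s.1, h • s.2⟩) x = x) ∧
          f x = a) := by
  choose S hS hgen using PermutationModule.exists_finset_closure_eq_invariants G A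
  obtain ⟨r, ⟨e⟩⟩ := Finite.exists_equiv_fin (Σ J : Subgroup G, S J)
  let I : Fin r → Subgroup G := fun j => (e.symm j).1
  let y : Fin r → A := fun j => (e.symm j).2
  have hy : ∀ j, ∀ h ∈ I j, h • y j = y j := fun j => hS _ _ (e.symm j).2.2
  have hsub (J : Subgroup G) : (S J : Set A) ⊆ {b | ∃ i, I i = J ∧ y i = b} :=
    fun b hb => ⟨e ⟨J, b, hb⟩, by simp [I], by simp only [y]; rw [e.symm_apply_apply]⟩
  have hlift := fun (J : Subgroup G) (a : A) (ha : ∀ h ∈ J, h • a = a) =>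
    PermutationModule.exists_invariant_sumMap_eq I y hy J
      (AddSubgroup.closure_mono (hsub J) (hgen J a ha))
  refine ⟨r, I, PermutationModule.sumMap I y hy, fun a => ?_,
    PermutationModule.sumMap_mapDomain I y hy, hlift⟩
  obtain ⟨x, -, hx⟩ := hlift ⊥ a fun h hh => by rw [Subgroup.mem_bot.mp hh, one_smul]
  exact ⟨x, hx⟩
end
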